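/- Let p be a prime with p ≡ 1 (mod 4), and write p = x² + y² with x ≡ 1 (mod 4) and y even. Then ∑_{k=0}^{p-1} C(2k,k)²/(-16)^k ≡ (-1)^{(p-1)/4} (2x - p/(2x)) (mod p²), where the sum and the quantity p/(2x) are interpreted in ℤ_p (both -16 and 2x being invertible modulo p²). -/

import Mathlib

section ModSquare

variable {p : ℕ} [Fact p.Prime]

omit [Fact p.Prime] in
theorem natCast_mul_eq_of_intModEq {a b : ℤ} (h : a ≡ b [ZMOD p]) :
    (p : ZMod (p ^ 2)) * a = p * b := by
  have : ((p * a : ℤ) : ZMod (p ^ 2)) = ((p * b : ℤ) : ZMod (p ^ 2)) := by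
    rw [ZMod.intCast_eq_intCast_iff, Nat.cast_pow, pow_two]
    exact h.mul_left'
  simpa using this

omit [Fact p.Prime] in
theorem natCast_mul_self_zmod_sq : (p : ZMod (p ^ 2)) * p = 0 := by
  rw [← pow_two, ← Nat.cast_pow, ZMod.natCast_self]

theorem isUnit_natCast_zmod_sq {r : ℕ} (h0 : 0 < r) (hr : r < p) :
    IsUnit (r : ZMod (p ^ 2)) := by
  rw [ZMod.isUnit_iff_coprime]
  exact (Nat.coprime_of_lt_prime h0.ne' hr Fact.out).symm.pow_right 2

theorem choose_pred_prime_modEq {r : ℕ} (hr : r < p) :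
    ((p - 1).choose r : ℤ) ≡ (-1) ^ r [ZMOD p] := by
  obtain ⟨q, hq⟩ : ∃ q, p = q + 1 := ⟨p - 1, by have := (Fact.out : p.Prime).pos; omega⟩
  induction r with
  | zero => simp [Int.ModEq.refl]
  | succ r ih =>
    have h1 := ih (by omega)
    have h2 : (p.choose (r + 1) : ℤ) ≡ 0 [ZMOD p] := by
      rw [Int.modEq_zero_iff_dvd]
      exact_mod_cast (Fact.out : p.Prime).dvd_choose_self (by omega) hr
    have h3 : (p.choose (r + 1) : ℤ) = (p - 1).choose r + (p - 1).choose (r + 1) := by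
      subst hq; simp [Nat.choose_succ_succ]
    have h4 := (h2.symm.trans (by rw [h3])).symm.sub h1
    rw [pow_succ]
    convert h4 using 1 <;> ring

theorem choose_mul_prime_add_modEq {M a r : ℕ} (hr : r < p) :
    (((M + 1) * p - 1).choose (p * a + r) : ℤ) ≡ M.choose a * (-1) ^ r [ZMOD p] := by
  have hp := (Fact.out : p.Prime).pos
  have h := Choose.choose_modEq_choose_mod_mul_choose_div (n := (M + 1) * p - 1)
    (k := p * a + r) (p := p)
  have e : (M + 1) * p - 1 = (p - 1) + p * M := by
    obtain ⟨q, rfl⟩ : ∃ q, p = q + 1 := ⟨p - 1, by omega⟩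
    simp only [Nat.add_sub_cancel]
    have : (M + 1) * (q + 1) = q + (q + 1) * M + 1 := by ring
    omega
  have e1 : ((M + 1) * p - 1) % p = p - 1 := by
    rw [e, Nat.add_mul_mod_self_left, Nat.mod_eq_of_lt (by omega)]
  have e2 : ((M + 1) * p - 1) / p = M := by
    rw [e, Nat.add_mul_div_left _ _ hp, Nat.div_eq_of_lt (by omega), zero_add]
  have e3 : (p * a + r) % p = r := by
    rw [Nat.mul_add_mod, Nat.mod_eq_of_lt hr]
  have e4 : (p * a + r) / p = a := by
    rw [Nat.mul_add_div hp, Nat.div_eq_of_lt hr, add_zero]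
  rw [e1, e2, e3, e4] at h
  refine h.trans ?_
  rw [mul_comm]
  exact (choose_pred_prime_modEq hr).mul_left _

theorem add_one_mul_choose_mul_prime_add (M a : ℕ) {r : ℕ} (hr : r + 1 < p) :
    ((r + 1 : ℕ) : ZMod (p ^ 2)) * (((M + 1) * p).choose (p * a + (r + 1)) : ℕ) =
      p * ((M + 1) * M.choose a * (-1) ^ r) := by
  have hp := (Fact.out : p.Prime).pos
  have hN : (M + 1) * p = ((M + 1) * p - 1) + 1 := by
    have : 0 < (M + 1) * p := by positivity
    omega
  have h1 := Nat.add_one_mul_choose_eq ((M + 1) * p - 1) (p * a + r)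
  rw [← hN] at h1
  have hd : p ∣ ((M + 1) * p).choose (p * a + (r + 1)) := by
    have h2 : p ∣ ((M + 1) * p).choose (p * a + (r + 1)) * (p * a + (r + 1)) := by
      rw [← add_assoc, ← h1, mul_assoc]
      exact Dvd.dvd.mul_left (dvd_mul_right _ _) _
    refine ((Fact.out : p.Prime).dvd_mul.1 h2).resolve_right fun h => ?_
    have := Nat.le_of_dvd (by omega) ((Nat.dvd_add_right (dvd_mul_right p a)).1 h)
    omega
  have h3 : (p : ZMod (p ^ 2)) * (((M + 1) * p).choose (p * a + (r + 1)) : ℕ) = 0 := by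
    obtain ⟨c, hc⟩ := hd
    rw [hc, Nat.cast_mul, ← mul_assoc, natCast_mul_self_zmod_sq, zero_mul]
  have h4 := natCast_mul_eq_of_intModEq (p := p)
    (choose_mul_prime_add_modEq (M := M) (a := a) (r := r) (by omega))
  have h5 := congrArg (Nat.cast : ℕ → ZMod (p ^ 2)) h1
  push_cast at h3 h4 h5 ⊢
  rw [← add_assoc] at *
  linear_combination -(a : ZMod (p ^ 2)) * h3 - h5 + (M + 1) * h4

theorem prime_dvd_choose_mul_prime (M : ℕ) {j : ℕ} (hj : ¬ p ∣ j) : p ∣ (M * p).choose j := by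
  have h := Choose.choose_modEq_choose_mod_mul_choose_div_nat (n := M * p) (k := j) (p := p)
  rw [Nat.mul_mod_left, Nat.choose_eq_zero_of_lt (Nat.pos_of_ne_zero fun h => hj
    (Nat.dvd_of_mod_eq_zero h)), zero_mul] at h
  exact (Nat.modEq_zero_iff_dvd).1 h

theorem choose_mul_prime_mul_prime (M a : ℕ) :
    (((M * p).choose (a * p) : ℕ) : ZMod (p ^ 2)) = (M.choose a : ℕ) := by
  have hp := (Fact.out : p.Prime)
  induction M generalizing a with
  | zero =>
    rcases Nat.eq_zero_or_pos a with rfl | ha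
    · simp
    · rw [zero_mul, Nat.choose_eq_zero_of_lt (Nat.mul_pos ha hp.pos),
        Nat.choose_eq_zero_of_lt ha]
  | succ M ih =>
    rcases a with _ | a
    · simp
    rw [add_mul M, one_mul, add_comm, Nat.add_choose_eq,
      Finset.Nat.sum_antidiagonal_eq_sum_range_succ
        (fun i j => p.choose i * (M * p).choose j), Nat.cast_sum,
      ← Finset.sum_subset (s₁ := {0, p}), Finset.sum_pair hp.ne_zero.symm]
    · have e : (a + 1) * p - p = a * p := by rw [add_mul, one_mul, Nat.add_sub_cancel]
      simp only [e, Nat.sub_zero, Nat.choose_zero_right, Nat.choose_self, one_mul]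
      rw [ih, ih, Nat.choose_succ_succ]; push_cast; ring
    · intro i hi
      simp only [Finset.mem_insert, Finset.mem_singleton] at hi
      rw [Finset.mem_range]
      rcases hi with rfl | rfl
      · positivity
      · nlinarith [Nat.zero_le (a * i)]
    · intro i hi hi'
      simp only [Finset.mem_insert, Finset.mem_singleton, not_or] at hi'
      rw [Finset.mem_range] at hi
      rcases lt_or_gt_of_ne hi'.2 with h | h
      · have h1 := hp.dvd_choose_self hi'.1 h
        have h2 : ¬ p ∣ (a + 1) * p - i := fun h3 => by
          have h4 := (Nat.dvd_sub_iff_right (Nat.lt_succ_iff.1 hi) (dvd_mul_left _ _)).1 h3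
          exact absurd (Nat.le_of_dvd (Nat.pos_of_ne_zero hi'.1) h4) (by omega)
        rw [ZMod.natCast_eq_zero_iff, pow_two]
        exact mul_dvd_mul h1 (prime_dvd_choose_mul_prime M h2)
      · rw [Nat.choose_eq_zero_of_lt h, zero_mul, Nat.cast_zero]

end ModSquare

theorem sum_choose_mul_choose_add_eq (m : ℕ) :
    (∑ k ∈ Finset.range (2 * m + 1), ((2 * m).choose k * (2 * m + k).choose k : ℤ)) =
      ∑ a ∈ Finset.range (m + 1),
        (-1 : ℤ) ^ a * (2 * m).choose a * (4 * m + 2 * (m - a)).choose (4 * m) := by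
  open PowerSeries in
  have key : (1 + X : ℤ⟦X⟧) ^ (2 * m) * (invOneSubPow ℤ (2 * m + 1)).val =
      (1 - X ^ 2) ^ (2 * m) * (invOneSubPow ℤ (4 * m + 1)).val := by
    have hu : ∀ d, (invOneSubPow ℤ d).val * (1 - X) ^ d = 1 := fun d => by
      rw [← invOneSubPow_inv_eq_one_sub_pow]; exact (invOneSubPow ℤ d).val_inv
    have h1 := hu (2 * m + 1)
    have h2 := hu (4 * m + 1)
    have h3 : (1 - X : ℤ⟦X⟧) ^ (4 * m + 1) = (1 - X) ^ (2 * m) * (1 - X) ^ (2 * m + 1) := by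
      rw [← pow_add]; congr 1; ring
    have h4 : (1 - X ^ 2 : ℤ⟦X⟧) ^ (2 * m) = (1 - X) ^ (2 * m) * (1 + X) ^ (2 * m) := by
      rw [← mul_pow]; congr 1; ring
    rw [h4]
    rw [h3] at h2
    calc _ = (1 + X : ℤ⟦X⟧) ^ (2 * m) * (invOneSubPow ℤ (2 * m + 1)).val *
          ((invOneSubPow ℤ (4 * m + 1)).val * ((1 - X) ^ (2 * m) * (1 - X) ^ (2 * m + 1))) := by
            rw [h2, mul_one]
      _ = (1 - X) ^ (2 * m) * (1 + X) ^ (2 * m) * (invOneSubPow ℤ (4 * m + 1)).val *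
          ((invOneSubPow ℤ (2 * m + 1)).val * (1 - X) ^ (2 * m + 1)) := by ring
      _ = _ := by rw [h1, mul_one]
  have hc := congrArg (PowerSeries.coeff (2 * m)) key
  rw [PowerSeries.coeff_mul, PowerSeries.invOneSubPow_val_succ_eq_mk_add_choose,
    PowerSeries.invOneSubPow_val_succ_eq_mk_add_choose,
    ← Finset.Nat.sum_antidiagonal_swap,
    Finset.Nat.sum_antidiagonal_eq_sum_range_succ_mk] at hc
  refine Eq.trans ?_ (hc.trans ?_)
  · refine Finset.sum_congr rfl fun k hk => ?_
    have hk' := Finset.mem_range_succ_iff.1 hk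
    simp only [Prod.swap, PowerSeries.coeff_mk]
    have : (1 + PowerSeries.X : PowerSeries ℤ) ^ (2 * m) =
        (((1 + Polynomial.X : Polynomial ℤ) ^ (2 * m) : Polynomial ℤ) : PowerSeries ℤ) := by
      simp
    rw [this, Polynomial.coeff_coe, Polynomial.coeff_one_add_X_pow, Nat.choose_symm hk',
      Nat.choose_symm_add]
  · have e (a : ℕ) : (-PowerSeries.X ^ 2 : PowerSeries ℤ) ^ a * 1 ^ (2 * m - a) *
        ((2 * m).choose a : PowerSeries ℤ) *
        PowerSeries.mk (fun n => ((4 * m + n).choose (4 * m) : ℤ)) =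
        PowerSeries.C ((-1) ^ a * ((2 * m).choose a : ℤ)) * (PowerSeries.X ^ (2 * a) *
        PowerSeries.mk (fun n => ((4 * m + n).choose (4 * m) : ℤ))) := by
      rw [neg_pow, ← pow_mul, map_mul, map_pow, map_neg, map_one, map_natCast]
      ring
    rw [sub_eq_neg_add, add_pow, Finset.sum_mul, map_sum,
      ← Finset.sum_subset (Finset.range_subset_range.2 (by omega : m + 1 ≤ 2 * m + 1))]
    · refine Finset.sum_congr rfl fun a ha => ?_
      have ha' := Finset.mem_range_succ_iff.1 ha
      rw [e, PowerSeries.coeff_C_mul, PowerSeries.coeff_X_pow_mul', if_pos (by omega),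
        PowerSeries.coeff_mk, Nat.mul_sub]
    · intro a _ ha
      rw [Finset.mem_range, not_lt] at ha
      rw [e, PowerSeries.coeff_C_mul, PowerSeries.coeff_X_pow_mul', if_neg (by omega), mul_zero]

open Nat in
theorem sum_neg_one_pow_choose_mul_inv_mul_descFactorial {R : Type*} [CommRing R] (v : ℕ → R)
    {K : ℕ} (hv : ∀ k, 0 < k → k ≤ K → k * v k = 1) {N M : ℕ} (hN : N < M) (hM : M ≤ K) :
    (∑ a ∈ Finset.range (N + 1), (-1) ^ a * (N.choose a : R) * v (M - a)) *
      (M.descFactorial (N + 1) : R) = (-1) ^ N * (N ! : R) := by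
  induction N generalizing M with
  | zero =>
    have := hv M hN hM
    simp only [zero_add, Finset.sum_range_one, Nat.sub_zero, Nat.descFactorial_one]
    simpa [mul_comm] using this
  | succ N ih =>
    obtain ⟨M, rfl⟩ : ∃ M', M = M' + 1 := ⟨M - 1, by omega⟩
    have h1 := ih (M := M + 1) (by omega) hM
    have h2 := ih (M := M) (by omega) (by omega)
    have hsum : ∑ a ∈ Finset.range (N + 1 + 1), (-1) ^ a * ((N + 1).choose a : R) * v (M + 1 - a) =
        (∑ a ∈ Finset.range (N + 1), (-1) ^ a * (N.choose a : R) * v (M + 1 - a)) -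
        ∑ a ∈ Finset.range (N + 1), (-1) ^ a * (N.choose a : R) * v (M - a) := by
      have h3 : ∑ a ∈ Finset.range (N + 1), (-1) ^ a * (N.choose a : R) * v (M + 1 - a) =
          ∑ a ∈ Finset.range (N + 1 + 1), (-1) ^ a * (N.choose a : R) * v (M + 1 - a) := by
        rw [Finset.sum_range_succ _ (N + 1), Nat.choose_succ_self]; simp
      rw [h3, Finset.sum_range_succ', Finset.sum_range_succ' _ (N + 1)]
      simp only [Nat.choose_succ_succ, Nat.cast_add, Nat.add_sub_add_right, mul_add, add_mul,
        Finset.sum_add_distrib, pow_succ]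
      simp only [mul_neg, mul_one, neg_mul, Finset.sum_neg_distrib, Nat.choose_zero_right]
      ring
    have h4 : ((M + 1).descFactorial (N + 1 + 1) : R) =
        (M - N) * ((M + 1).descFactorial (N + 1) : R) := by
      rw [Nat.descFactorial_succ (M + 1) (N + 1), Nat.cast_mul, Nat.cast_sub (by omega)]
      push_cast; ring
    have h5 : ((M + 1).descFactorial (N + 1 + 1) : R) =
        (M + 1) * (M.descFactorial (N + 1) : R) := by
      rw [Nat.succ_descFactorial_succ]; push_cast; ring
    rw [hsum, sub_mul]
    nth_rewrite 1 [h4]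
    rw [h5, Nat.factorial_succ, Nat.cast_mul, pow_succ]
    push_cast
    linear_combination (M - N : R) * h1 - (M + 1 : R) * h2

section ModSquare

variable {p : ℕ} [Fact p.Prime]

open Nat in
theorem factorial_mul_factorial_modEq {k l : ℕ} (h : p = k + l + 1) :
    (k ! * l ! : ℤ) ≡ -(-1) ^ k [ZMOD p] := by
  have h1 := choose_pred_prime_modEq (p := p) (r := k) (by omega)
  have h2 := Nat.add_choose_mul_factorial_mul_factorial k l
  rw [← Nat.choose_symm_add] at h2
  have h3 := ZMod.wilsons_lemma p
  have e : p - 1 = k + l := by omega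
  rw [e] at h1 h3
  rw [← ZMod.intCast_eq_intCast_iff] at h1 ⊢
  have h4 := congrArg (Nat.cast : ℕ → ZMod p) h2
  have h5 : ((-1 : ZMod p) ^ k) * (-1) ^ k = 1 := by rw [← mul_pow]; simp
  push_cast at *
  rw [h3, h1] at h4
  linear_combination (-1) ^ k * h4 - (k ! * l ! : ZMod p) * h5

open Nat in
theorem choose_mul_sum_choose_eq_prime {m : ℕ} (hp : p = 4 * m + 1) :
    ((∑ a ∈ Finset.range (2 * m), (2 * m * p).choose (p * a + (3 * m - a)) : ℕ) :
      ZMod (p ^ 2)) * ((2 * m).choose m : ℕ) = p ∧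
    (p : ZMod (p ^ 2)) ∣
      ((∑ a ∈ Finset.range (2 * m), (2 * m * p).choose (p * a + (3 * m - a)) : ℕ) :
        ZMod (p ^ 2)) := by
  have hm : 0 < m := by
    have := (Fact.out : p.Prime).two_le
    omega
  obtain ⟨M, hM⟩ : ∃ M, 2 * m = M + 1 := ⟨2 * m - 1, by omega⟩
  have hv : ∀ k : ℕ, 0 < k → k ≤ 3 * m → (k : ZMod (p ^ 2)) * (k : ZMod (p ^ 2))⁻¹ = 1 :=
    fun k h1 h2 => ZMod.mul_inv_of_unit _ (isUnit_natCast_zmod_sq h1 (by omega))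
  have h1 := sum_neg_one_pow_choose_mul_inv_mul_descFactorial (fun k => (k : ZMod (p ^ 2))⁻¹) hv
    (N := M) (M := 3 * m) (by omega) le_rfl
  set f : ZMod (p ^ 2) := ∑ a ∈ Finset.range (M + 1), (-1) ^ a * (M.choose a : ZMod (p ^ 2)) *
      ((3 * m - a : ℕ) : ZMod (p ^ 2))⁻¹
    with hf
  have hE : ((∑ a ∈ Finset.range (2 * m), (2 * m * p).choose (p * a + (3 * m - a)) : ℕ) :
      ZMod (p ^ 2)) =
      p * (2 * m * (-1) ^ (m + 1) * f) := by
    rw [hf, Nat.cast_sum, Finset.mul_sum, Finset.mul_sum, hM]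
    refine Finset.sum_congr rfl fun a ha => ?_
    rw [Finset.mem_range] at ha
    obtain ⟨s, hs⟩ : ∃ s, 3 * m - a = s + 1 := ⟨3 * m - a - 1, by omega⟩
    have h2 := add_one_mul_choose_mul_prime_add (p := p) M a (r := s) (by omega)
    have h3 := hv (s + 1) (by omega) (by omega)
    have h4 : (-1 : ZMod (p ^ 2)) ^ s = (-1) ^ (m + 1) * (-1) ^ a := by
      have : (-1 : ZMod (p ^ 2)) ^ s * ((-1) ^ (m + 1) * (-1) ^ a) = 1 := by
        rw [← pow_add, ← pow_add]
        exact Even.neg_one_pow ⟨2 * m, by omega⟩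
      have h5 : ((-1 : ZMod (p ^ 2)) ^ (m + 1) * (-1) ^ a) * ((-1) ^ (m + 1) * (-1) ^ a) = 1 := by
        rw [← pow_add, ← pow_add]; exact Even.neg_one_pow ⟨_, rfl⟩
      linear_combination ((-1 : ZMod (p ^ 2)) ^ (m + 1) * (-1) ^ a) * this -
        (-1 : ZMod (p ^ 2)) ^ s * h5
    have hM' : (2 * m : ZMod (p ^ 2)) = M + 1 := by
      simpa using congrArg (Nat.cast : ℕ → ZMod (p ^ 2)) hM
    rw [hs, hM']
    rw [h4] at h2
    push_cast at h2 h3 ⊢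
    linear_combination ((s + 1 : ZMod (p ^ 2)))⁻¹ * h2 -
      (((M + 1) * p).choose (p * a + (s + 1)) : ZMod (p ^ 2)) * h3
  have hM' : (2 * m : ZMod (p ^ 2)) = M + 1 := by
      simpa using congrArg (Nat.cast : ℕ → ZMod (p ^ 2)) hM
  have hdf : ((3 * m).descFactorial (M + 1) : ZMod (p ^ 2)) * (m ! : ZMod (p ^ 2)) =
      ((3 * m)! : ZMod (p ^ 2)) := by
    have := Nat.factorial_mul_descFactorial (by omega : 2 * m ≤ 3 * m)
    rw [show 3 * m - 2 * m = m by omega] at this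
    rw [← hM, mul_comm, ← this, Nat.cast_mul]
  have hC : ((2 * m).choose m : ZMod (p ^ 2)) * (m ! * m !) = ((2 * m)! : ZMod (p ^ 2)) := by
    have := Nat.add_choose_mul_factorial_mul_factorial m m
    rw [← two_mul] at this
    rw [← this, Nat.cast_mul, Nat.cast_mul, mul_assoc]
  have hfac : ((2 * m)! : ZMod (p ^ 2)) = 2 * m * (M ! : ZMod (p ^ 2)) := by
    rw [hM, Nat.factorial_succ, hM', Nat.cast_mul, Nat.cast_succ]
  have hsgn : (-1 : ZMod (p ^ 2)) ^ M = -1 := Odd.neg_one_pow (by rw [Nat.odd_iff]; omega)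
  have w1 := natCast_mul_eq_of_intModEq
    (factorial_mul_factorial_modEq (p := p) (k := m) (l := 3 * m) (by omega))
  have w2 := natCast_mul_eq_of_intModEq
    (factorial_mul_factorial_modEq (p := p) (k := 2 * m) (l := 2 * m) (by omega))
  rw [hE]
  refine ⟨?_, dvd_mul_right _ _⟩
  rw [hsgn] at h1
  push_cast at w1 w2
  rw [pow_mul, neg_one_sq, one_pow] at w2
  rw [pow_succ (-1 : ZMod (p ^ 2))]
  set C := ((2 * m).choose m : ZMod (p ^ 2))
  set d := ((3 * m).descFactorial (M + 1) : ZMod (p ^ 2))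
  linear_combination (-2 * m * f * C) * w1 - (2 * m * f * C * p * m !) * hdf +
    (2 * m * C * p * m ! ^ 2) * h1 + (C * p * m ! ^ 2) * hfac - ((2 * m)! * p) * hC - w2

theorem natCast_mul_choose_prime_sub_one_eq {r : ℕ} {q : ℕ} (hq : p = q + 1) (hr : 0 < r)
    (hr' : r ≤ p) : (r : ZMod (p ^ 2)) * ((q + r).choose q : ℕ) = p := by
  have h1 := Nat.choose_succ_right_eq (q + r) q
  rw [Nat.add_sub_cancel_left, ← hq] at h1
  have h2 := Choose.choose_modEq_choose_mod_mul_choose_div (n := q + r) (k := p) (p := p)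
  have hp := (Fact.out : p.Prime).pos
  obtain ⟨s, rfl⟩ : ∃ s, r = s + 1 := ⟨r - 1, by omega⟩
  have e : q + (s + 1) = s + p := by omega
  rw [e, Nat.mod_self, Nat.div_self hp, Nat.choose_zero_right, Nat.choose_one_right,
    Nat.add_div_right _ hp, Nat.div_eq_of_lt (by omega)] at h2
  have h3 := natCast_mul_eq_of_intModEq h2
  have h4 := congrArg (Nat.cast : ℕ → ZMod (p ^ 2)) h1
  rw [e] at h4 ⊢
  push_cast at h3 h4 ⊢
  linear_combination h3 - h4

theorem two_mul_choose_eq_choose_mul_sub {m a : ℕ} (hp : p = 4 * m + 1) (ha : a < m) :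
    (2 : ZMod (p ^ 2)) * ((2 * m * p).choose (p * a + (m - a)) : ℕ) =
      (-1) ^ m * (-1) ^ a * ((2 * m).choose a : ℕ) *
        (((4 * m + 2 * (m - a)).choose (4 * m) : ℕ) - 2 * p) := by
  obtain ⟨M, hM⟩ : ∃ M, 2 * m = M + 1 := ⟨2 * m - 1, by omega⟩
  obtain ⟨s, hs⟩ : ∃ s, m - a = s + 1 := ⟨m - a - 1, by omega⟩
  have h1 := add_one_mul_choose_mul_prime_add (p := p) M a (r := s) (by omega)
  have h2 := natCast_mul_choose_prime_sub_one_eq (p := p) (q := 4 * m) (r := 2 * (m - a)) hp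
    (by omega) (by omega)
  have h3 := Nat.choose_mul_succ_eq M a
  have e : M + 1 - a = m + (s + 1) := by omega
  rw [e] at h3
  have h4 := congrArg (Nat.cast : ℕ → ZMod (p ^ 2)) h3
  have h5 : (-1 : ZMod (p ^ 2)) ^ m * (-1) ^ a = -(-1) ^ s := by
    have : m = s + 1 + a := by omega
    conv_lhs => rw [this]
    rw [← pow_add, add_assoc, ← two_mul, pow_add, pow_mul, neg_one_sq, one_pow, pow_succ]
    ring
  have hp0 : (p : ZMod (p ^ 2)) = 4 * m + 1 := by
    simpa using congrArg (Nat.cast : ℕ → ZMod (p ^ 2)) hp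
  have hpp := natCast_mul_self_zmod_sq (p := p)
  have u : IsUnit ((2 * (s + 1) : ℕ) : ZMod (p ^ 2)) :=
    isUnit_natCast_zmod_sq (by omega) (by omega)
  rw [hs] at h2 ⊢
  rw [h5, hM]
  refine u.mul_left_cancel ?_
  push_cast at *
  set x := (((M + 1) * p).choose (p * a + (s + 1)) : ZMod (p ^ 2))
  set y := ((4 * m + 2 * (s + 1)).choose (4 * m) : ZMod (p ^ 2))
  set c := (M.choose a : ZMod (p ^ 2))
  set c' := ((M + 1).choose a : ZMod (p ^ 2))
  linear_combination 4 * h1 + 4 * p * (-1) ^ s * h4 + (-1) ^ s * c' * h2 +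
    (-1) ^ s * c' * hpp - p * (-1) ^ s * c' * hp0

theorem two_mul_sum_choose_eq {m : ℕ} (hp : p = 4 * m + 1) :
    (2 : ZMod (p ^ 2)) *
        (∑ a ∈ Finset.range m, (2 * m * p).choose (p * a + (m - a)) : ℕ) =
      (-1) ^ m * (∑ k ∈ Finset.range (2 * m + 1), (2 * m).choose k * (2 * m + k).choose k : ℕ)
        - ((2 * m).choose m : ℕ) + p * ((2 * m).choose m : ℕ) := by
  have hm : 0 < m := by
    have := (Fact.out : p.Prime).two_le
    omega
  obtain ⟨μ, rfl⟩ : ∃ μ, m = μ + 1 := ⟨m - 1, by omega⟩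
  have hD := congrArg (Int.cast : ℤ → ZMod (p ^ 2)) (sum_choose_mul_choose_add_eq (μ + 1))
  have hA := congrArg (Int.cast : ℤ → ZMod (p ^ 2))
    (Int.alternating_sum_range_choose_eq_choose (n := 2 * μ + 1) (m := μ))
  have hC : ((2 * (μ + 1)).choose (μ + 1) : ZMod (p ^ 2)) = 2 * (2 * μ + 1).choose μ := by
    have : (2 * (μ + 1)).choose (μ + 1) = 2 * (2 * μ + 1).choose μ := by
      rw [show 2 * (μ + 1) = 2 * μ + 1 + 1 by ring, Nat.choose_succ_succ,
        Nat.choose_symm_half]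
      ring
    rw [this]; push_cast; ring
  have h1 : ((-1 : ZMod (p ^ 2)) ^ (μ + 1)) * (-1) ^ (μ + 1) = 1 := by
    rw [← pow_add]; exact Even.neg_one_pow ⟨_, rfl⟩
  rw [Nat.cast_sum, Finset.mul_sum, Finset.sum_congr rfl fun a ha =>
    two_mul_choose_eq_choose_mul_sub hp (Finset.mem_range.1 ha)]
  rw [Finset.sum_range_succ _ (μ + 1)] at hD
  simp only [mul_sub, mul_assoc, Finset.sum_sub_distrib, ← Finset.mul_sum]
  have h2 (c d : ℕ → ZMod (p ^ 2)) (b : ZMod (p ^ 2)) : ∑ i ∈ Finset.range (μ + 1),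
      c i * (d i * b) = (∑ i ∈ Finset.range (μ + 1), c i * d i) * b := by
    rw [Finset.sum_mul]
    exact Finset.sum_congr rfl fun i _ => (mul_assoc _ _ _).symm
  rw [h2]
  push_cast at hD hA ⊢
  rw [show 2 * μ + 1 + 1 = 2 * (μ + 1) by ring] at hA
  simp only [Nat.sub_self, mul_zero, add_zero, Nat.choose_self, Nat.cast_one, mul_one,
    mul_assoc] at hD
  rw [hA, hD]
  rw [pow_succ (-1 : ZMod (p ^ 2))] at h1 ⊢
  linear_combination (p * 2 * (2 * μ + 1).choose μ -
    ((2 * (μ + 1)).choose (μ + 1) : ZMod (p ^ 2))) * h1 - p * hC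

theorem natCast_mul_neg_one_pow_mul_sum_choose_mul_choose {m : ℕ} (hp : p = 4 * m + 1) :
    (p : ZMod (p ^ 2)) * ((-1) ^ m *
      ((∑ k ∈ Finset.range (2 * m + 1), (2 * m).choose k * (2 * m + k).choose k : ℕ) :
        ZMod (p ^ 2))) =
      (p : ZMod (p ^ 2)) * (((2 * m).choose m : ℕ) : ZMod (p ^ 2)) := by
  have h1 := two_mul_sum_choose_eq hp
  have h2 : (p : ZMod (p ^ 2)) *
      ((∑ a ∈ Finset.range m, (2 * m * p).choose (p * a + (m - a)) : ℕ) : ZMod (p ^ 2)) = 0 := by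
    rw [Nat.cast_sum, Finset.mul_sum]
    refine Finset.sum_eq_zero fun a ha => ?_
    rw [Finset.mem_range] at ha
    rw [← Nat.cast_mul, ZMod.natCast_eq_zero_iff, pow_two]
    refine mul_dvd_mul_left _ (prime_dvd_choose_mul_prime _ fun h => ?_)
    have := Nat.le_of_dvd (by omega) ((Nat.dvd_add_right (dvd_mul_right p a)).1 h)
    omega
  have hpp := natCast_mul_self_zmod_sq (p := p)
  linear_combination (2 : ZMod (p ^ 2)) * h2 - p * h1 - ((2 * m).choose m : ZMod (p ^ 2)) * hpp

theorem mul_eq_sq_sub_of_mul_self_eq_zero {R : Type*} [CommRing R] {q x E C d e : R}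
    (hx : x = (1 - q) * (E + C + (d - C + q * C))) (he : E = q * e) (hE : E * C = q)
    (hd : q * d = q * C) (hq : q * q = 0) : x * d = x ^ 2 - q := by
  have hx' : x = E + d := by linear_combination hx - q * he - hd - (C + e) * hq
  rw [hx']
  linear_combination -(E + d - C + e * q) * he - e * hd - hE - e ^ 2 * hq

theorem mul_neg_one_pow_mul_sum_choose_mul_choose_eq {m : ℕ} (hp : p = 4 * m + 1)
    {x : ZMod (p ^ 2)}
    (hx : x = (1 - (p : ZMod (p ^ 2))) *
      (((∑ a ∈ Finset.range (2 * m), (2 * m * p).choose (p * a + (3 * m - a)) : ℕ) :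
          ZMod (p ^ 2)) +
        (((2 * m * p).choose (m * p) : ℕ) : ZMod (p ^ 2)) +
        2 * ((∑ a ∈ Finset.range m, (2 * m * p).choose (p * a + (m - a)) : ℕ) :
          ZMod (p ^ 2)))) :
    x * ((-1) ^ m *
      ((∑ k ∈ Finset.range (2 * m + 1), (2 * m).choose k * (2 * m + k).choose k : ℕ) :
        ZMod (p ^ 2))) = x ^ 2 - (p : ZMod (p ^ 2)) := by
  obtain ⟨hE, e, he⟩ := choose_mul_sum_choose_eq_prime hp
  rw [choose_mul_prime_mul_prime, two_mul_sum_choose_eq hp] at hx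
  exact mul_eq_sq_sub_of_mul_self_eq_zero hx he hE
    (natCast_mul_neg_one_pow_mul_sum_choose_mul_choose hp) natCast_mul_self_zmod_sq

end ModSquare

section CharSum

variable {F : Type*} [Field F] [Fintype F] [DecidableEq F]

open Finset

/-- The character sum `∑ t, χ (t (t² - k))` attached to the curve `y² = t³ - k t`. -/
def cubicCharSum (F : Type*) [Field F] [Fintype F] [DecidableEq F] (k : F) : ℤ :=
  ∑ t : F, quadraticChar F t * quadraticChar F (t ^ 2 - k)

theorem sum_quadraticChar_sub_mul_quadraticChar_sub (hF : ringChar F ≠ 2) (a b : F) :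
    ∑ k : F, quadraticChar F (a - k) * quadraticChar F (b - k) =
      (if a = b then (Fintype.card F : ℤ) else 0) - 1 := by
  split_ifs with h
  · subst h
    refine (Equiv.sum_comp (Equiv.subLeft a) fun x => quadraticChar F x * quadraticChar F x).trans ?_
    have h1 (x : F) : quadraticChar F x * quadraticChar F x = 1 - if x = 0 then 1 else 0 := by
      split_ifs with hx
      · simp [hx]
      · rw [← pow_two, quadraticChar_sq_one hx, sub_zero]
    simp only [h1, Finset.sum_sub_distrib]
    simp
  · have h0 : b - a ≠ 0 := sub_ne_zero.2 (Ne.symm h)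
    have h1 := jacobiSum_nontrivial_inv (quadraticChar_ne_one hF)
    rw [(quadraticChar_isQuadratic F).inv, jacobiSum] at h1
    rw [← Equiv.sum_comp ((Equiv.mulLeft₀ (b - a) h0).trans (Equiv.addLeft a))]
    have h2 (x : F) : quadraticChar F (a - (a + (b - a) * x)) *
        quadraticChar F (b - (a + (b - a) * x)) =
        quadraticChar F (-1) * (quadraticChar F x * quadraticChar F (1 - x)) := by
      rw [show a - (a + (b - a) * x) = -1 * ((b - a) * x) by ring,
        show b - (a + (b - a) * x) = (b - a) * (1 - x) by ring, map_mul, map_mul, map_mul]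
      linear_combination (quadraticChar F (-1) * quadraticChar F x * quadraticChar F (1 - x)) *
        quadraticChar_sq_one h0
    simp only [Equiv.trans_apply, Equiv.mulLeft₀_apply, Equiv.coe_addLeft, h2, ← Finset.mul_sum, h1]
    have := quadraticChar_sq_one (neg_ne_zero.2 (one_ne_zero (α := F)))
    linear_combination -this

theorem cubicCharSum_zero (hF : ringChar F ≠ 2) : cubicCharSum F 0 = 0 := by
  rw [← quadraticChar_sum_zero hF, cubicCharSum]
  refine Finset.sum_congr rfl fun t _ => ?_
  by_cases ht : t = 0
  · simp [ht]
  · rw [sub_zero, quadraticChar_sq_one' ht, mul_one]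

theorem cubicCharSum_mul_sq (k : F) {u : F} (hu : u ≠ 0) :
    cubicCharSum F (k * u ^ 2) = quadraticChar F u * cubicCharSum F k := by
  rw [cubicCharSum, ← Equiv.sum_comp (Equiv.mulLeft₀ u hu), cubicCharSum, Finset.mul_sum]
  refine Finset.sum_congr rfl fun t _ => ?_
  rw [Equiv.mulLeft₀_apply, show (u * t) ^ 2 - k * u ^ 2 = u ^ 2 * (t ^ 2 - k) by ring, map_mul,
    map_mul, quadraticChar_sq_one' hu]
  ring

theorem sum_cubicCharSum_sq (hF : ringChar F ≠ 2) (h1 : quadraticChar F (-1) = 1) :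
    ∑ k : F, cubicCharSum F k ^ 2 = 2 * Fintype.card F * (Fintype.card F - 1) := by
  have hexp (k : F) : cubicCharSum F k ^ 2 = ∑ t : F, ∑ s : F, quadraticChar F t *
      quadraticChar F s * (quadraticChar F (t ^ 2 - k) * quadraticChar F (s ^ 2 - k)) := by
    rw [pow_two, cubicCharSum, Finset.sum_mul_sum]
    exact Finset.sum_congr rfl fun t _ => Finset.sum_congr rfl fun s _ => by ring
  have h2 : (2 : F) ≠ 0 := Ring.two_ne_zero hF
  have hin (t : F) : ∑ s : F, quadraticChar F t * quadraticChar F s *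
      ((if t ^ 2 = s ^ 2 then (Fintype.card F : ℤ) else 0) - 1) =
      2 * Fintype.card F * (1 - if t = 0 then 1 else 0) := by
    have hs (s : F) : quadraticChar F t * quadraticChar F s *
        ((if t ^ 2 = s ^ 2 then (Fintype.card F : ℤ) else 0) - 1) =
        Fintype.card F * ((if s = t then quadraticChar F t * quadraticChar F t else 0) +
          if s = -t then quadraticChar F t * quadraticChar F t else 0) -
        quadraticChar F t * quadraticChar F s := by
      have hneg : quadraticChar F (-t) = quadraticChar F t := by
        rw [← neg_one_mul, map_mul, h1, one_mul]
      by_cases e1 : s = t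
      · by_cases e2 : s = -t
        · have ht : t = 0 := by
            have : 2 * t = 0 := by linear_combination e2 - e1
            exact (mul_eq_zero.1 this).resolve_left h2
          simp [e1, ht]
        · rw [if_pos e1, if_neg e2, e1, if_pos rfl]; ring
      · by_cases e2 : s = -t
        · rw [if_neg e1, if_pos e2, e2, if_pos (by ring), hneg]; ring
        · rw [if_neg e1, if_neg e2, if_neg]
          · ring
          · intro h
            rcases sq_eq_sq_iff_eq_or_eq_neg.1 h.symm with h | h
            exacts [e1 h, e2 h]
    simp only [hs, Finset.sum_sub_distrib, ← Finset.mul_sum, quadraticChar_sum_zero hF,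
      Finset.sum_add_distrib, Finset.sum_ite_eq', Finset.mem_univ, if_true, mul_zero, sub_zero]
    split_ifs with ht
    · simp [ht]
    · rw [← pow_two, quadraticChar_sq_one ht]; ring
  simp only [hexp]
  rw [Finset.sum_comm]
  have : ∀ t : F, ∑ k : F, ∑ s : F, quadraticChar F t *
      quadraticChar F s * (quadraticChar F (t ^ 2 - k) * quadraticChar F (s ^ 2 - k)) =
      2 * Fintype.card F * (1 - if t = 0 then 1 else 0) := by
    intro t
    rw [Finset.sum_comm, ← hin t]
    refine Finset.sum_congr rfl fun s _ => ?_
    rw [← Finset.mul_sum, sum_quadraticChar_sub_mul_quadraticChar_sub hF]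
  simp only [this, ← Finset.mul_sum, Finset.sum_sub_distrib]
  simp

theorem cubicCharSum_sq_add_sq (hF : ringChar F ≠ 2) (h1 : quadraticChar F (-1) = 1) {g : F}
    (hg : quadraticChar F g = -1) :
    cubicCharSum F 1 ^ 2 + cubicCharSum F g ^ 2 = 4 * Fintype.card F := by
  have hg0 : g ≠ 0 := by rintro rfl; simp at hg
  have hsq (k : F) {u : F} (hu : u ≠ 0) : cubicCharSum F (k * u ^ 2) ^ 2 = cubicCharSum F k ^ 2 := by
    rw [cubicCharSum_mul_sq k hu, mul_pow, quadraticChar_sq_one hu, one_mul]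
  have hk (k : F) : 2 * cubicCharSum F k ^ 2 =
      (1 - if k = 0 then 1 else 0) * (cubicCharSum F 1 ^ 2 + cubicCharSum F g ^ 2) +
        quadraticChar F k * (cubicCharSum F 1 ^ 2 - cubicCharSum F g ^ 2) := by
    by_cases h0 : k = 0
    · simp [h0, cubicCharSum_zero hF]
    rw [if_neg h0]
    rcases quadraticChar_dichotomy h0 with h | h
    · obtain ⟨u, rfl⟩ := (quadraticChar_one_iff_isSquare h0).1 h
      have hu : u ≠ 0 := by rintro rfl; simp at h0
      have := hsq 1 hu
      rw [one_mul, pow_two u] at this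
      rw [h, this]; ring
    · have h0' : k * g ≠ 0 := mul_ne_zero h0 hg0
      have h' : quadraticChar F (k * g) = 1 := by rw [map_mul, h, hg]; rfl
      obtain ⟨u, hu⟩ := (quadraticChar_one_iff_isSquare h0').1 h'
      have hu0 : u ≠ 0 := by rintro rfl; simp [h0, hg0] at hu
      have hkg : k = g * (u / g) ^ 2 := by
        field_simp; rw [hu, pow_two]
      have := hsq g (div_ne_zero hu0 hg0)
      rw [← hkg] at this
      rw [h, this]; ring
  have hsum := sum_cubicCharSum_sq hF h1
  have h3 : 2 * ∑ k : F, cubicCharSum F k ^ 2 =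
      (Fintype.card F - 1) * (cubicCharSum F 1 ^ 2 + cubicCharSum F g ^ 2) := by
    rw [Finset.mul_sum]
    simp only [hk, Finset.sum_add_distrib, ← Finset.sum_mul, quadraticChar_sum_zero hF,
      Finset.sum_sub_distrib]
    simp
  have hc : (Fintype.card F : ℤ) - 1 ≠ 0 := by
    have := Fintype.one_lt_card (α := F)
    omega
  refine mul_left_cancel₀ hc ?_
  linear_combination 2 * hsum - h3

theorem four_dvd_card_filter_quadraticChar {i : F} (hF : ringChar F ≠ 2) (hi : i ^ 2 = -1) :
    4 ∣ #{t : F | quadraticChar F t * quadraticChar F (t ^ 2 - 1) = -1} := by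
  have h2 : (2 : F) ≠ 0 := Ring.two_ne_zero hF
  have hi0 : i ≠ 0 := by rintro rfl; simp at hi
  have h1 : quadraticChar F (-1) = 1 := by rw [← hi, quadraticChar_sq_one' hi0]
  set B : Finset F := {t : F | quadraticChar F t * quadraticChar F (t ^ 2 - 1) = -1} with hB
  have hneg {t : F} (ht : t ∈ B) : -t ∈ B := by
    rw [hB, Finset.mem_filter_univ] at ht ⊢
    rwa [neg_sq, ← neg_one_mul, map_mul, h1, one_mul]
  have hne {t : F} (ht : t ∈ B) : t ≠ 0 := by
    rintro rfl
    simp [hB] at ht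
  have hinv {t : F} (ht : t ∈ B) : t⁻¹ ∈ B := by
    have h0 := hne ht
    rw [hB, Finset.mem_filter_univ] at ht ⊢
    have h3 : t⁻¹ = t * (t⁻¹) ^ 2 := by field_simp
    have h4 : t⁻¹ ^ 2 - 1 = -1 * (t⁻¹ ^ 2 * (t ^ 2 - 1)) := by field_simp; ring
    rw [h4]
    conv_lhs => enter [1]; rw [h3]
    rwa [map_mul, map_mul, map_mul, quadraticChar_sq_one' (inv_ne_zero h0), h1, one_mul, mul_one,
      one_mul]
  have hsq {t : F} (ht : t ∈ B) : t ^ 2 ≠ 1 := by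
    intro h
    simp [hB, h] at ht
  have hsq' {t : F} (ht : t ∈ B) : t ^ 2 ≠ -1 := by
    intro h
    have h0 := hne ht
    rw [hB, Finset.mem_filter_univ, ← map_mul] at ht
    have h5 : (1 - t) ≠ 0 := by
      intro h'
      have : t = 1 := by linear_combination -h'
      rw [this] at h
      exact h2 (by linear_combination h)
    rw [show t * (t ^ 2 - 1) = (1 - t) ^ 2 by linear_combination (t - 1) * h,
      quadraticChar_sq_one' h5] at ht
    norm_num at ht
  rw [Finset.card_eq_sum_card_image (fun t : F => t ^ 2 + t⁻¹ ^ 2) B]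
  refine Finset.dvd_sum fun c hc => ?_
  obtain ⟨t, ht, rfl⟩ := Finset.mem_image.1 hc
  have h0 := hne ht
  have hfib : B.filter (fun s : F => s ^ 2 + s⁻¹ ^ 2 = t ^ 2 + t⁻¹ ^ 2) =
      {t, -t, t⁻¹, -t⁻¹} := by
    ext s
    simp only [Finset.mem_filter, Finset.mem_insert, Finset.mem_singleton]
    constructor
    · rintro ⟨hs, h⟩
      have hs0 := hne hs
      have h3 : (s - t) * (s + t) * ((s * t - 1) * (s * t + 1)) = 0 := by
        field_simp at h
        linear_combination h
      rcases mul_eq_zero.1 h3 with h | h <;> rcases mul_eq_zero.1 h with h | h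
      · exact Or.inl (sub_eq_zero.1 h)
      · exact Or.inr (Or.inl (eq_neg_of_add_eq_zero_left h))
      · exact Or.inr (Or.inr (Or.inl (eq_inv_of_mul_eq_one_left (sub_eq_zero.1 h))))
      · refine Or.inr (Or.inr (Or.inr (neg_eq_iff_eq_neg.1 (eq_inv_of_mul_eq_one_left ?_))))
        linear_combination -h
    · rintro (rfl | rfl | rfl | rfl)
      · exact ⟨ht, rfl⟩
      · exact ⟨hneg ht, by rw [inv_neg, neg_sq, neg_sq]⟩
      · exact ⟨hinv ht, by rw [inv_inv, add_comm]⟩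
      · exact ⟨hneg (hinv ht), by rw [inv_neg, neg_sq, neg_sq, inv_inv, add_comm]⟩
  rw [hfib]
  have a1 : t ≠ -t := fun h =>
    h0 ((mul_eq_zero.1 (by linear_combination h : 2 * t = 0)).resolve_left h2)
  have a2 : t ≠ t⁻¹ := fun h => hsq ht (by field_simp at h; exact h)
  have a3 : t ≠ -t⁻¹ := fun h => hsq' ht (by field_simp at h; exact h)
  have a4 : -t ≠ t⁻¹ := fun h => a3 (by rw [← h, neg_neg])
  have a5 : -t ≠ -t⁻¹ := fun h => a2 (neg_injective h)
  have a6 : t⁻¹ ≠ -t⁻¹ := fun h => a1 (by simpa using congrArg (fun z => z⁻¹) h)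
  rw [Finset.card_insert_of_notMem (by simp [a1, a2, a3]),
    Finset.card_insert_of_notMem (by simp [a4, a5]),
    Finset.card_insert_of_notMem (by simp [a6]), Finset.card_singleton]

theorem cubicCharSum_one_modEq {i : F} (hF : ringChar F ≠ 2) (hi : i ^ 2 = -1) :
    cubicCharSum F 1 ≡ Fintype.card F - 3 [ZMOD 8] := by
  obtain ⟨c, hc⟩ := four_dvd_card_filter_quadraticChar hF hi
  have h2 : (2 : F) ≠ 0 := Ring.two_ne_zero hF
  have h11 : (1 : F) ≠ -1 := fun h => h2 (by linear_combination h)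
  have hf (t : F) : quadraticChar F t * quadraticChar F (t ^ 2 - 1) =
      (1 - ((if t = 0 then 1 else 0) + (if t = 1 then 1 else 0) + if t = -1 then 1 else 0)) -
        2 * if quadraticChar F t * quadraticChar F (t ^ 2 - 1) = -1 then 1 else 0 := by
    by_cases t0 : t = 0
    · simp [t0]
    by_cases t1 : t = 1
    · simp [t1, h11]
    by_cases t2 : t = -1
    · simp [t2, h11.symm]
    have h3 : t ^ 2 - 1 ≠ 0 := by
      rw [sub_ne_zero, Ne, sq_eq_one_iff]
      tauto
    rw [if_neg t0, if_neg t1, if_neg t2]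
    rcases quadraticChar_dichotomy t0 with h | h <;>
      rcases quadraticChar_dichotomy h3 with h' | h' <;> rw [h, h'] <;> norm_num
  have h4 : cubicCharSum F 1 = Fintype.card F - 3 - 2 * (4 * c : ℕ) := by
    rw [cubicCharSum, Finset.sum_congr rfl fun t _ => hf t, ← hc, Finset.sum_sub_distrib,
      ← Finset.mul_sum, Finset.sum_boole, Finset.sum_sub_distrib, Finset.sum_add_distrib,
      Finset.sum_add_distrib]
    simp
  rw [h4]
  refine (Int.modEq_iff_dvd.2 ⟨c, ?_⟩)
  push_cast; ring

end CharSum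

theorem sq_eq_sq_of_sq_add_sq_eq_prime {p : ℕ} (hp : p.Prime) {x y a b : ℤ}
    (hx : Odd x) (ha : Odd a) (hp2 : p ≠ 2)
    (h1 : (p : ℤ) = x ^ 2 + y ^ 2) (h2 : (p : ℤ) = a ^ 2 + b ^ 2) : x ^ 2 = a ^ 2 := by
  have key : ∀ b : ℤ, (p : ℤ) = a ^ 2 + b ^ 2 → (p : ℤ) ∣ x * b - a * y → x ^ 2 = a ^ 2 := by
    rintro b h2 ⟨k, hk⟩
    have hp0 : (p : ℤ) ≠ 0 := by exact_mod_cast hp.ne_zero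
    have h3 : (p * k) ^ 2 + (x * a + y * b) ^ 2 = (p : ℤ) ^ 2 := by
      rw [← hk]
      linear_combination (-p : ℤ) * h2 - (a ^ 2 + b ^ 2) * h1
    have hk1 : k ^ 2 ≤ 1 := by
      have hpos : (0 : ℤ) < (p : ℤ) ^ 2 := by positivity
      nlinarith [sq_nonneg (x * a + y * b)]
    have hk2 : k ^ 2 = 0 ∨ k ^ 2 = 1 := by have := sq_nonneg k; omega
    rcases hk2 with hk2 | hk2
    · have hk0 : k = 0 := by simpa using hk2
      rw [hk0, mul_zero, sub_eq_zero] at hk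
      refine mul_left_cancel₀ hp0 ?_
      linear_combination x ^ 2 * h2 - a ^ 2 * h1 + (x * b + a * y) * hk
    · have h4 : x * a + y * b = 0 := by
        rw [mul_pow, hk2, mul_one] at h3
        exact pow_eq_zero_iff two_ne_zero |>.1 (by linarith)
      have h5 : (p : ℤ) = x ^ 2 + a ^ 2 := by
        refine mul_left_cancel₀ hp0 ?_
        linear_combination (y * b - x * a) * h4 + (p - x ^ 2) * h2 + b ^ 2 * h1
      have h6 : Even (p : ℤ) := by rw [h5]; exact hx.pow.add_odd ha.pow
      exact absurd (hp.even_iff.1 (by exact_mod_cast h6)) hp2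
  have hdvd : (p : ℤ) ∣ (x * b - a * y) * (x * b - a * (-y)) := by
    refine ⟨x ^ 2 - a ^ 2, ?_⟩
    linear_combination a ^ 2 * h1 - x ^ 2 * h2
  rcases (Nat.prime_iff_prime_int.1 hp).dvd_or_dvd hdvd with h | h
  · exact key b h2 h
  · refine key (-b) (by rw [h2]; ring) ?_
    rw [show x * -b - a * y = -(x * b - a * -y) by ring]
    exact h.neg_right

theorem sum_range_two_mul_add_one_eq {R : Type*} [AddCommMonoid R] (f : ℕ → R) (n : ℕ) :
    ∑ i ∈ Finset.range (2 * n + 1), f i =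
      ∑ a ∈ Finset.range (n + 1), f (2 * a) + ∑ a ∈ Finset.range n, f (2 * a + 1) := by
  induction n with
  | zero => simp
  | succ n ih =>
    rw [show 2 * (n + 1) + 1 = 2 * n + 1 + 1 + 1 by ring, Finset.sum_range_succ,
      Finset.sum_range_succ, ih, Finset.sum_range_succ (fun a => f (2 * a)) (n + 1),
      Finset.sum_range_succ (fun a => f (2 * a + 1)) n,
      show 2 * (n + 1) = 2 * n + 1 + 1 by ring]
    abel

theorem sum_range_two_mul_add_one_eq_of_symm {R : Type*} [CommSemiring R] (f : ℕ → R) (n : ℕ)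
    (hf : ∀ a < n, f (2 * n - a) = f a) :
    ∑ i ∈ Finset.range (2 * n + 1), f i = f n + 2 * ∑ a ∈ Finset.range n, f a := by
  have h : ∑ a ∈ Finset.range n, f (n + 1 + a) = ∑ a ∈ Finset.range n, f a := by
    rw [← Finset.sum_range_reflect f n]
    refine Finset.sum_congr rfl fun a ha => ?_
    rw [Finset.mem_range] at ha
    rw [← hf (n - 1 - a) (by omega)]
    congr 1
    omega
  rw [show 2 * n + 1 = n + 1 + n by ring, Finset.sum_range_add, h, Finset.sum_range_succ]
  ring

section ModSquare

variable {p : ℕ} [Fact p.Prime]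

omit [Fact p.Prime] in
theorem intCast_pow_eq_of_modEq {a b : ℤ} (h : a ≡ b [ZMOD p]) :
    (a : ZMod (p ^ 2)) ^ p = (b : ZMod (p ^ 2)) ^ p := by
  have h1 := dvd_sub_pow_of_dvd_sub h.symm.dvd 1
  rw [pow_one, ← Nat.cast_pow, ← ZMod.intCast_zmod_eq_zero_iff_dvd] at h1
  push_cast at h1
  exact sub_eq_zero.1 h1

theorem intCast_quadraticChar_eq_pow {m : ℕ} (hp : p = 4 * m + 1) (a : ℤ) :
    ((quadraticChar (ZMod p) a : ℤ) : ZMod (p ^ 2)) = (a : ZMod (p ^ 2)) ^ (2 * m * p) := by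
  have hchar : ringChar (ZMod p) ≠ 2 := by rw [ZMod.ringChar_zmod_n]; omega
  have h1 := quadraticChar_eq_pow_of_char_ne_two' hchar (a : ZMod p)
  rw [ZMod.card, show p / 2 = 2 * m by omega] at h1
  have h2 : quadraticChar (ZMod p) (a : ZMod p) ≡ a ^ (2 * m) [ZMOD p] := by
    rw [← ZMod.intCast_eq_intCast_iff]
    push_cast
    exact h1
  have h3 := intCast_pow_eq_of_modEq h2
  have h4 : quadraticChar (ZMod p) (a : ZMod p) ^ p = quadraticChar (ZMod p) (a : ZMod p) := by
    have hodd : Odd p := ⟨2 * m, by omega⟩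
    by_cases h0 : (a : ZMod p) = 0
    · simp [h0, (Fact.out : p.Prime).ne_zero]
    · rcases quadraticChar_dichotomy h0 with h | h <;> rw [h]
      · exact one_pow p
      · exact hodd.neg_one_pow
  rw [← Int.cast_pow, h4] at h3
  rw [h3, Int.cast_pow, ← pow_mul]

theorem sum_val_pow_pow_eq {K : ℕ} (hK : 0 < K) :
    ∑ t : ZMod p, ((t.val : ZMod (p ^ 2)) ^ p) ^ K =
      if p - 1 ∣ K then (p : ZMod (p ^ 2)) - 1 else 0 := by
  have hp := (Fact.out : p.Prime)
  have hpow {a b : ℤ} (h : (a : ZMod p) = b) : (a : ZMod (p ^ 2)) ^ p = (b : ZMod (p ^ 2)) ^ p :=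
    intCast_pow_eq_of_modEq ((ZMod.intCast_eq_intCast_iff _ _ _).1 h)
  split_ifs with hd
  · obtain ⟨l, rfl⟩ := hd
    have h1 (t : ZMod p) : ((t.val : ZMod (p ^ 2)) ^ p) ^ ((p - 1) * l) =
        1 - if t = 0 then 1 else 0 := by
      split_ifs with ht
      · rw [ht, ZMod.val_zero, Nat.cast_zero, zero_pow hp.ne_zero, zero_pow hK.ne', sub_self]
      · have := hpow (a := (t.val : ℤ) ^ (p - 1)) (b := 1) (by
          push_cast
          rw [ZMod.natCast_zmod_val, ZMod.pow_card_sub_one_eq_one ht])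
        push_cast at this
        rw [pow_mul, ← pow_mul _ p, mul_comm p, pow_mul _ _ p, this, one_pow, one_pow, sub_zero]
    simp only [h1, Finset.sum_sub_distrib]
    simp [ZMod.card]
  · obtain ⟨u, hu⟩ : ∃ u : (ZMod p)ˣ, u ^ K ≠ 1 := by
      by_contra! h
      rw [FiniteField.forall_pow_eq_one_iff, ZMod.card] at h
      exact hd h
    have h1 (t : ZMod p) : ((((u : ZMod p) * t).val : ZMod (p ^ 2)) ^ p) ^ K =
        (((u : ZMod p).val : ZMod (p ^ 2)) ^ p) ^ K * ((t.val : ZMod (p ^ 2)) ^ p) ^ K := by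
      have := hpow (a := (((u : ZMod p) * t).val : ℤ)) (b := ((u : ZMod p).val * t.val : ℤ)) (by
        push_cast
        simp only [ZMod.natCast_zmod_val])
      push_cast at this
      rw [this, mul_pow, mul_pow]
    have h2 := Equiv.sum_comp (Equiv.mulLeft₀ (u : ZMod p) u.ne_zero)
      fun t : ZMod p => ((t.val : ZMod (p ^ 2)) ^ p) ^ K
    simp only [Equiv.mulLeft₀_apply, h1, ← Finset.mul_sum] at h2
    have h3 : IsUnit ((((u : ZMod p).val : ZMod (p ^ 2)) ^ p) ^ K - 1) := by
      have := (ZMod.coe_int_isUnit_iff_isCoprime ((((u : ZMod p).val : ℤ) ^ p) ^ K - 1)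
        (p ^ 2)).2 (by
        rw [Nat.cast_pow]
        refine IsCoprime.pow_left ?_
        rw [(Nat.prime_iff_prime_int.1 hp).coprime_iff_not_dvd,
          ← ZMod.intCast_zmod_eq_zero_iff_dvd]
        push_cast
        rw [ZMod.natCast_zmod_val, ZMod.pow_card, sub_eq_zero]
        exact fun h => hu (Units.ext (by simpa using h)))
      push_cast at this
      exact this
    refine h3.mul_left_cancel ?_
    rw [mul_zero, sub_mul, one_mul, h2, sub_self]

theorem cubicCharSum_eq_sum_range {m : ℕ} (hp : p = 4 * m + 1) :
    ((cubicCharSum (ZMod p) 1 : ℤ) : ZMod (p ^ 2)) =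
      ∑ j ∈ Finset.range (2 * m * p + 1), (-1) ^ j * ((2 * m * p).choose j : ZMod (p ^ 2)) *
        if 2 * m ∣ m + j then (p : ZMod (p ^ 2)) - 1 else 0 := by
  have hm : 0 < m := by
    have := (Fact.out : p.Prime).two_le
    omega
  have h1 (t : ZMod p) :
      ((quadraticChar (ZMod p) t * quadraticChar (ZMod p) (t ^ 2 - 1) : ℤ) : ZMod (p ^ 2)) =
      ∑ j ∈ Finset.range (2 * m * p + 1), (-1) ^ j * ((2 * m * p).choose j : ZMod (p ^ 2)) *
        ((t.val : ZMod (p ^ 2)) ^ p) ^ (2 * m + 2 * j) := by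
    have h2 := intCast_quadraticChar_eq_pow hp (t.val : ℤ)
    have h3 := intCast_quadraticChar_eq_pow hp (((t.val : ℤ) ^ p) ^ 2 - 1)
    push_cast at h2 h3
    rw [ZMod.natCast_zmod_val] at h2 h3
    rw [ZMod.pow_card] at h3
    rw [Int.cast_mul, h2, h3, sub_eq_add_neg, add_pow, Finset.mul_sum, mul_comm (2 * m) p, pow_mul]
    refine Finset.sum_congr rfl fun j hj => ?_
    rw [Finset.mem_range] at hj
    have h4 : (-1 : ZMod (p ^ 2)) ^ (p * (2 * m) - j) = (-1) ^ j := by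
      have e : Even (p * (2 * m)) := ⟨p * m, by ring⟩
      rw [neg_one_pow_congr]
      rw [Nat.even_sub (by omega)]
      simp [e]
    rw [h4, pow_add, pow_mul _ 2 j]
    ring
  rw [cubicCharSum, Int.cast_sum, Finset.sum_congr rfl fun t _ => h1 t, Finset.sum_comm]
  refine Finset.sum_congr rfl fun j _ => ?_
  rw [← Finset.mul_sum, sum_val_pow_pow_eq (by omega)]
  congr 2
  rw [show p - 1 = 2 * (2 * m) by omega, ← mul_add, Nat.mul_dvd_mul_iff_left two_pos]

theorem cubicCharSum_eq_sum_choose {m : ℕ} (hp : p = 4 * m + 1) :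
    ((cubicCharSum (ZMod p) 1 : ℤ) : ZMod (p ^ 2)) =
      ((p : ZMod (p ^ 2)) - 1) * (-1) ^ m *
        ∑ i ∈ Finset.range (2 * (2 * m) + 1),
          ((2 * m * p).choose (m * (2 * i + 1)) : ZMod (p ^ 2)) := by
  have hm : 0 < m := by
    have := (Fact.out : p.Prime).two_le
    omega
  rw [cubicCharSum_eq_sum_range hp]
  simp only [mul_ite, mul_zero]
  rw [← Finset.sum_filter, Finset.mul_sum]
  symm
  refine Finset.sum_nbij (fun i => m * (2 * i + 1)) ?_ ?_ ?_ ?_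
  · intro i hi
    rw [Finset.mem_range] at hi
    rw [Finset.mem_filter, Finset.mem_range]
    refine ⟨?_, i + 1, by ring⟩
    have : m * (2 * i + 1) ≤ m * (2 * p) := Nat.mul_le_mul_left _ (by omega)
    linarith
  · intro i _ j _ h
    have := Nat.eq_of_mul_eq_mul_left hm h
    omega
  · intro j hj
    rw [Finset.mem_coe, Finset.mem_filter, Finset.mem_range] at hj
    obtain ⟨hj, c, hc⟩ := hj
    have hc0 : c ≠ 0 := by rintro rfl; omega
    obtain ⟨i, rfl⟩ := Nat.exists_eq_succ_of_ne_zero hc0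
    have hji : j = m * (2 * i + 1) := by
      have : 2 * m * (i + 1) = m * (2 * i + 1) + m := by ring
      rw [Nat.succ_eq_add_one] at hc
      omega
    refine ⟨i, ?_, hji.symm⟩
    rw [Finset.mem_coe, Finset.mem_range]
    have : m * (2 * i + 1) ≤ m * (2 * p) := by rw [← hji]; linarith
    have := Nat.le_of_mul_le_mul_left this hm
    omega
  · intro i _
    have : (-1 : ZMod (p ^ 2)) ^ (m * (2 * i + 1)) = (-1) ^ m := by
      rw [mul_comm, pow_mul, Odd.neg_one_pow ⟨i, rfl⟩]
    rw [this]
    ring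

omit [Fact p.Prime] in
theorem sum_choose_mul_odd_eq {m : ℕ} (hp : p = 4 * m + 1) :
    ∑ i ∈ Finset.range (2 * (2 * m) + 1), (2 * m * p).choose (m * (2 * i + 1)) =
      (∑ a ∈ Finset.range (2 * m), (2 * m * p).choose (p * a + (3 * m - a))) +
        (2 * m * p).choose (m * p) +
        2 * ∑ a ∈ Finset.range m, (2 * m * p).choose (p * a + (m - a)) := by
  have h1 (a : ℕ) : m * (2 * (2 * a + 1) + 1) = p * a + 3 * m - a := by
    have : p * a + 3 * m = m * (2 * (2 * a + 1) + 1) + a := by rw [hp]; ring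
    omega
  have h2 (a : ℕ) : m * (2 * (2 * a) + 1) = p * a + m - a := by
    have : p * a + m = m * (2 * (2 * a) + 1) + a := by rw [hp]; ring
    omega
  rw [sum_range_two_mul_add_one_eq (R := ℕ), sum_range_two_mul_add_one_eq_of_symm]
  · rw [add_comm, ← add_assoc]
    congr 2
    · refine Finset.sum_congr rfl fun a ha => ?_
      rw [Finset.mem_range] at ha
      rw [h1, Nat.add_sub_assoc (by omega)]
    · rw [hp]; ring_nf
    · refine Finset.sum_congr rfl fun a ha => ?_
      rw [Finset.mem_range] at ha
      rw [h2, Nat.add_sub_assoc (by omega)]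
  · intro a ha
    refine Nat.choose_symm_of_eq_add ?_
    obtain ⟨b, rfl⟩ : ∃ b, m = a + b := ⟨m - a, by omega⟩
    rw [show 2 * (a + b) - a = a + 2 * b by omega, hp]
    ring

theorem cubicCharSum_one_eq {m : ℕ} (hp : p = 4 * m + 1) {x y : ℤ}
    (hxy : (p : ℤ) = x ^ 2 + y ^ 2) (hx : x ≡ 1 [ZMOD 4]) :
    cubicCharSum (ZMod p) 1 = -(-1) ^ m * (2 * x) := by
  have hchar : ringChar (ZMod p) ≠ 2 := by rw [ZMod.ringChar_zmod_n]; omega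
  obtain ⟨i, hi⟩ := ZMod.exists_sq_eq_neg_one_iff.2 (show p % 4 ≠ 3 by omega)
  rw [← pow_two] at hi
  have hneg : quadraticChar (ZMod p) (-1) = 1 := by
    rw [hi, quadraticChar_sq_one']
    rintro rfl
    simp at hi
  obtain ⟨g, hg⟩ := quadraticChar_exists_neg_one hchar
  have hsq := cubicCharSum_sq_add_sq hchar hneg hg
  have hmod := cubicCharSum_one_modEq hchar hi.symm
  rw [ZMod.card] at hsq hmod
  obtain ⟨c, hc⟩ := hmod.dvd
  obtain ⟨a, ha⟩ : ∃ a, a = 2 * (m : ℤ) - 1 - 4 * c := ⟨_, rfl⟩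
  have ha' : cubicCharSum (ZMod p) 1 = 2 * a := by omega
  rw [ha'] at hsq ⊢
  obtain ⟨b, hb⟩ : Even (cubicCharSum (ZMod p) g) := by
    have : Even (cubicCharSum (ZMod p) g ^ 2) := ⟨2 * p - 2 * a ^ 2, by linear_combination hsq⟩
    exact (Int.even_pow.1 this).1
  rw [hb] at hsq
  have hxo : Odd x := by
    rw [Int.odd_iff]
    have : x % 4 = 1 := hx
    omega
  have hao : Odd a := ⟨m - 1 - 2 * c, by omega⟩
  have hxa := sq_eq_sq_of_sq_add_sq_eq_prime Fact.out hxo hao (by omega) hxy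
    (show (p : ℤ) = a ^ 2 + b ^ 2 by linarith)
  have hx4 : x % 4 = 1 := hx
  rcases Nat.even_or_odd m with hm | hm
  · rw [hm.neg_one_pow]
    obtain ⟨k, rfl⟩ := hm
    rcases sq_eq_sq_iff_eq_or_eq_neg.1 hxa with h | h <;> push_cast at * <;> omega
  · rw [hm.neg_one_pow]
    obtain ⟨k, rfl⟩ := hm
    rcases sq_eq_sq_iff_eq_or_eq_neg.1 hxa with h | h <;> push_cast at * <;> omega

theorem choose_mul_choose_add_eq {m : ℕ} (hp : p = 4 * m + 1) {w : ZMod (p ^ 2)}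
    (hw : -16 * w = 1) {k : ℕ} (hk : k ≤ 2 * m) :
    (((2 * m).choose k * (2 * m + k).choose k : ℕ) : ZMod (p ^ 2)) =
      ((2 * k).choose k : ZMod (p ^ 2)) ^ 2 * w ^ k := by
  induction k with
  | zero => simp
  | succ k ih =>
    have h := ih (by omega)
    obtain ⟨r, hr⟩ : ∃ r, 2 * m = k + r := ⟨2 * m - k, by omega⟩
    have h1 := congrArg (Nat.cast : ℕ → ZMod (p ^ 2)) (Nat.choose_succ_right_eq (2 * m) k)
    have h2 := congrArg (Nat.cast : ℕ → ZMod (p ^ 2)) (Nat.add_one_mul_choose_eq (2 * m + k) k)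
    have h3 := congrArg (Nat.cast : ℕ → ZMod (p ^ 2)) (Nat.succ_mul_centralBinom_succ k)
    simp only [Nat.centralBinom_eq_two_mul_choose] at h3
    have hr' := congrArg (Nat.cast : ℕ → ZMod (p ^ 2)) hr
    have hp' := congrArg (Nat.cast : ℕ → ZMod (p ^ 2)) hp
    have hpp := natCast_mul_self_zmod_sq (p := p)
    have u : IsUnit ((k + 1 : ℕ) : ZMod (p ^ 2)) := isUnit_natCast_zmod_sq (by omega) (by omega)
    rw [show 2 * m - k = r by omega] at h1
    rw [show 2 * m + (k + 1) = 2 * m + k + 1 by ring]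
    refine (u.mul u).mul_left_cancel ?_
    push_cast at *
    rw [hp'] at hpp
    have h4 : 4 * (r * (2 * m + k + 1)) = -(2 * k + 1 : ZMod (p ^ 2)) ^ 2 := by
      linear_combination hpp - 4 * (2 * m + k + 1) * hr'
    have h5 : ((k + 1) * ((2 * (k + 1)).choose (k + 1) : ZMod (p ^ 2))) ^ 2 =
      (2 * (2 * k + 1) * ((2 * k).choose k : ZMod (p ^ 2))) ^ 2 := by rw [h3]
    generalize ((2 * m).choose (k + 1) : ZMod (p ^ 2)) = A' at *
    generalize ((2 * m).choose k : ZMod (p ^ 2)) = A at *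
    generalize ((2 * m + k + 1).choose (k + 1) : ZMod (p ^ 2)) = B' at *
    generalize ((2 * m + k).choose k : ZMod (p ^ 2)) = B at *
    generalize ((2 * (k + 1)).choose (k + 1) : ZMod (p ^ 2)) = C' at *
    generalize ((2 * k).choose k : ZMod (p ^ 2)) = C at *
    have h6 : (k + 1) * (k + 1) * (A' * B') = A * B * (r * (2 * m + k + 1)) := by
      linear_combination B' * (k + 1) * h1 - A * r * h2
    rw [pow_succ w]
    linear_combination h6 + r * (2 * m + k + 1) * h - w ^ k * w * h5 -
      4 * C ^ 2 * w ^ k * w * h4 - r * (2 * m + k + 1) * C ^ 2 * w ^ k * hw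

theorem sum_choose_mul_choose_add_eq_sum_range_prime {m : ℕ} (hp : p = 4 * m + 1)
    {w : ZMod (p ^ 2)} (hw : -16 * w = 1) :
    ((∑ k ∈ Finset.range (2 * m + 1), (2 * m).choose k * (2 * m + k).choose k : ℕ) :
      ZMod (p ^ 2)) = ∑ k ∈ Finset.range p, ((2 * k).choose k : ZMod (p ^ 2)) ^ 2 * w ^ k := by
  have hsub : Finset.range (2 * m + 1) ⊆ Finset.range p :=
    Finset.range_subset_range.2 (by omega)
  rw [← Finset.sum_subset hsub fun k hk hk' => ?_, Nat.cast_sum]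
  · refine Finset.sum_congr rfl fun k hk => choose_mul_choose_add_eq hp hw ?_
    rw [Finset.mem_range] at hk
    omega
  · rw [Finset.mem_range] at hk hk'
    have hd : p ∣ (2 * k).choose k :=
      (Fact.out : p.Prime).dvd_choose hk (by omega) (by omega)
    have h0 : ((2 * k).choose k : ZMod (p ^ 2)) ^ 2 = 0 := by
      rw [← Nat.cast_pow, ZMod.natCast_eq_zero_iff]
      exact pow_dvd_pow_of_dvd hd 2
    rw [h0, zero_mul]

theorem PadicInt.isUnit_intCast_of_not_dvd {a : ℤ} (h : ¬(p : ℤ) ∣ a) : IsUnit (a : ℤ_[p]) := by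
  rw [PadicInt.isUnit_iff]
  refine le_antisymm (PadicInt.norm_le_one _) (not_lt.1 ?_)
  rwa [PadicInt.norm_int_lt_one_iff_dvd]

theorem two_mul_eq_sum_choose {m : ℕ} (hp : p = 4 * m + 1) {x y : ℤ}
    (hxy : (p : ℤ) = x ^ 2 + y ^ 2) (hx : x ≡ 1 [ZMOD 4]) :
    (2 * x : ZMod (p ^ 2)) = (1 - (p : ZMod (p ^ 2))) *
      (((∑ a ∈ Finset.range (2 * m), (2 * m * p).choose (p * a + (3 * m - a)) : ℕ) :
          ZMod (p ^ 2)) +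
        (((2 * m * p).choose (m * p) : ℕ) : ZMod (p ^ 2)) +
        2 * ((∑ a ∈ Finset.range m, (2 * m * p).choose (p * a + (m - a)) : ℕ) :
          ZMod (p ^ 2))) := by
  have h := cubicCharSum_eq_sum_choose hp
  have h1 := congrArg (Nat.cast : ℕ → ZMod (p ^ 2)) (sum_choose_mul_odd_eq hp)
  rw [Nat.cast_sum, Nat.cast_add, Nat.cast_add, Nat.cast_mul, Nat.cast_ofNat] at h1
  rw [h1] at h
  rw [cubicCharSum_one_eq hp hxy hx] at h
  have h2 : (-1 : ZMod (p ^ 2)) ^ m * (-1) ^ m = 1 := by rw [← mul_pow]; simp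
  rw [Int.cast_mul, Int.cast_neg, Int.cast_pow, Int.cast_neg, Int.cast_one, Int.cast_mul,
    Int.cast_ofNat] at h
  have key (s Y : ZMod (p ^ 2)) (hs : s * s = 1)
      (h : -s * (2 * (x : ZMod (p ^ 2))) = ((p : ZMod (p ^ 2)) - 1) * s * Y) :
      2 * (x : ZMod (p ^ 2)) = (1 - (p : ZMod (p ^ 2))) * Y := by
    linear_combination -s * h - (2 * (x : ZMod (p ^ 2)) - (1 - (p : ZMod (p ^ 2))) * Y) * hs
  exact key _ _ h2 h
end ModSquare

/-- Let `p ≡ 1 (mod 4)` be a prime with `p = x² + y²`, `x ≡ 1 (mod 4)`, `y` even. Then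
`∑_{k=0}^{p-1} C(2k,k)²/(-16)^k ≡ (-1)^{(p-1)/4} (2x - p/(2x)) (mod p²)` in `ℤ_p`. -/
theorem sum_central_binom_sq_div_neg_sixteen (p : ℕ) [Fact p.Prime] (h1 : p % 4 = 1)
    (x y : ℤ) (hxy : (p : ℤ) = x ^ 2 + y ^ 2) (hx : x ≡ 1 [ZMOD 4]) (hy : Even y) :
    ∃ z : ℤ_[p],
      (∑ k ∈ Finset.range p, ((2 * k).choose k : ℚ_[p]) ^ 2 / (-16) ^ k) -
        (-1) ^ ((p - 1) / 4) * (2 * (x : ℚ_[p]) - (p : ℚ_[p]) / (2 * (x : ℚ_[p]))) =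
      (p : ℚ_[p]) ^ 2 * z := by
  obtain ⟨m, hp⟩ : ∃ m, p = 4 * m + 1 := ⟨p / 4, by omega⟩
  have hprime := (Fact.out : p.Prime)
  rw [show (p - 1) / 4 = m by omega]
  have hp2 : ¬(p : ℤ) ∣ 2 := fun h => by
    have := Int.le_of_dvd two_pos h
    have := hprime.two_le
    omega
  have hpr : Prime (p : ℤ) := Nat.prime_iff_prime_int.1 hprime
  have hx0 : x ≠ 0 := by rintro rfl; exact absurd hx (by decide)
  have hpx : ¬(p : ℤ) ∣ x := fun h => by
    obtain ⟨c, rfl⟩ := h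
    have hc : 0 < c ^ 2 := by
      have : c ≠ 0 := by rintro rfl; simp at hx0
      positivity
    have h := mul_le_mul_of_nonneg_left (Int.add_one_le_iff.2 hc) (sq_nonneg (p : ℤ))
    have : (2 : ℤ) ≤ p := by exact_mod_cast hprime.two_le
    nlinarith [sq_nonneg y]
  obtain ⟨v, hv⟩ := (PadicInt.isUnit_intCast_of_not_dvd (p := p) (a := 2 * x) fun h =>
    (hpr.dvd_or_dvd h).elim hp2 hpx).exists_right_inv
  obtain ⟨u, hu⟩ := (PadicInt.isUnit_intCast_of_not_dvd (p := p) (a := -2 ^ 4) fun h =>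
    hp2 (hpr.dvd_of_dvd_pow ((dvd_neg).1 h))).exists_right_inv
  push_cast at hu hv
  have hw : -16 * PadicInt.toZModPow 2 u = 1 := by
    have := congrArg (PadicInt.toZModPow (p := p) 2) hu
    simp only [map_mul, map_neg, map_one, map_ofNat] at this
    linear_combination this
  have hkey := mul_neg_one_pow_mul_sum_choose_mul_choose_eq hp (two_mul_eq_sum_choose hp hxy hx)
  rw [sum_choose_mul_choose_add_eq_sum_range_prime hp hw] at hkey
  have hker : 2 * (x : ℤ_[p]) * ((-1) ^ m *
      ∑ k ∈ Finset.range p, ((2 * k).choose k : ℤ_[p]) ^ 2 * u ^ k) -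
      ((2 * (x : ℤ_[p])) ^ 2 - p) ∈ RingHom.ker (PadicInt.toZModPow (p := p) 2) := by
    rw [RingHom.mem_ker, map_sub, sub_eq_zero]
    simpa only [map_mul, map_sub, map_sum, map_pow, map_natCast, map_intCast, map_neg, map_one,
      map_ofNat] using hkey
  rw [PadicInt.ker_toZModPow, Ideal.mem_span_singleton] at hker
  obtain ⟨c, hc⟩ := hker
  have hu' := congrArg (PadicInt.Coe.ringHom (p := p)) hu
  have hv' := congrArg (PadicInt.Coe.ringHom (p := p)) hv
  have hc' := congrArg (PadicInt.Coe.ringHom (p := p)) hc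
  simp only [map_mul, map_sub, map_sum, map_pow, map_natCast, map_intCast, map_neg, map_one,
    map_ofNat] at hu' hv' hc'
  rw [eq_inv_of_mul_eq_one_right hu'] at hc'
  simp only [inv_pow, ← div_eq_mul_inv] at hc'
  have hs : ((-1 : ℚ_[p]) ^ m) * (-1) ^ m = 1 := by rw [← mul_pow]; simp
  refine ⟨(-1) ^ m * c * v, ?_⟩
  change _ = _ * PadicInt.Coe.ringHom ((-1) ^ m * c * v)
  simp only [map_mul, map_pow, map_neg, map_one]
  rw [div_eq_mul_inv (p : ℚ_[p]), ← eq_inv_of_mul_eq_one_right hv']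
  linear_combination (-1) ^ m * PadicInt.Coe.ringHom v * hc' -
    (∑ k ∈ Finset.range p, ((2 * k).choose k : ℚ_[p]) ^ 2 / (-16) ^ k) *
      (((-1) ^ m) ^ 2 * hv' + hs) + (-1) ^ m * (2 * x) * hv'
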